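/- Let N = 2, let Ω ⊂ ℝ² be a bounded domain with C³ boundary and unit area, and let p ∈ [1, +∞). If 0 ≤ λ < λ₁(Ω, p) := (8π/(p+1))^{(p−1)/(2p)} · Λ(Ω, p+1)^{(p+1)/(2p)}, then every solution (α, ψ) of problem (P)_λ on Ω satisfies α > 0; in other words λ_+(Ω, p) ≥ λ₁(Ω, p). -/

import Mathlib

open MeasureTheory Metric Set

noncomputable section

/-- The Laplacian of a function on Euclidean space. -/
def lapl {N : ℕ} (f : EuclideanSpace ℝ (Fin N) → ℝ) (x : EuclideanSpace ℝ (Fin N)) : ℝ :=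
  ∑ i : Fin N,
    fderiv ℝ (fun y => fderiv ℝ f y (EuclideanSpace.single i (1 : ℝ))) x
      (EuclideanSpace.single i (1 : ℝ))

/-- `(α, ψ)` is a solution of problem `(P)_λ` on `Ω`:
`ψ ∈ C²`, `-Δψ = (max (α + λψ) 0)^p` in `Ω`, `ψ = 0` on `∂Ω`, and
`∫_Ω (max (α + λψ) 0)^p = 1`. -/
def IsSol {N : ℕ} (Ω : Set (EuclideanSpace ℝ (Fin N))) (p lam α : ℝ)
    (ψ : EuclideanSpace ℝ (Fin N) → ℝ) : Prop :=
  ContDiff ℝ 2 ψ ∧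
  (∀ x ∈ Ω, -lapl ψ x = (max (α + lam * ψ x) 0) ^ p) ∧
  (∀ x ∈ frontier Ω, ψ x = 0) ∧
  (∫ x in Ω, (max (α + lam * ψ x) 0) ^ p) = 1

/-- `Ω` is a bounded domain of class `C³`: open, connected, bounded, and near every
boundary point `Ω` is the sublevel set of a `C³` function with nonvanishing gradient. -/
def IsC3Domain {N : ℕ} (Ω : Set (EuclideanSpace ℝ (Fin N))) : Prop :=
  IsOpen Ω ∧ IsConnected Ω ∧ Bornology.IsBounded Ω ∧
  ∀ x ∈ frontier Ω, ∃ (U : Set (EuclideanSpace ℝ (Fin N)))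
      (f : EuclideanSpace ℝ (Fin N) → ℝ),
    IsOpen U ∧ x ∈ U ∧ ContDiff ℝ 3 f ∧ (∀ y ∈ U, fderiv ℝ f y ≠ 0) ∧
    Ω ∩ U = {y ∈ U | f y < 0}

/-- `Λ(Ω, t)`: the infimum of `(∫_Ω ‖∇w‖²) / (∫_Ω |w|^t)^(2/t)` over nonzero smooth
compactly supported `w` with support contained in `Ω`. -/
def Lam {N : ℕ} (Ω : Set (EuclideanSpace ℝ (Fin N))) (t : ℝ) : ℝ :=
  sInf {r : ℝ | ∃ w : EuclideanSpace ℝ (Fin N) → ℝ, ContDiff ℝ (⊤ : ℕ∞) w ∧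
    HasCompactSupport w ∧ tsupport w ⊆ Ω ∧ w ≠ 0 ∧
    r = (∫ x in Ω, ‖gradient w x‖ ^ 2) / (∫ x in Ω, |w x| ^ t) ^ (2 / t)}

section IsoperimetricBound

open scoped Pointwise ENNReal

/-- One-dimensional Brunn–Minkowski inequality. -/
theorem Real.volume_add_le_volume_add {U V : Set ℝ} (hU : MeasurableSet U)
    (hV : MeasurableSet V) (hUn : U.Nonempty) (hVn : V.Nonempty) :
    volume U + volume V ≤ volume (U + V) := by
  have compact_case : ∀ {K L : Set ℝ}, IsCompact K → IsCompact L → K.Nonempty → L.Nonempty →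
      volume K + volume L ≤ volume (K + L) := by
    intro K L hK hL hKn hLn
    obtain ⟨a, haK, ha⟩ := hK.exists_isGreatest hKn
    obtain ⟨b, hbL, hb⟩ := hL.exists_isLeast hLn
    have hdisj : AEDisjoint volume (b +ᵥ K) (a +ᵥ L) := by
      refine measure_mono_null (t := {a + b}) ?_ (by simp)
      rintro _ ⟨⟨x, hx, rfl⟩, ⟨y, hy, hxy⟩⟩
      have h1 := ha hx
      have h2 := hb hy
      simp only [vadd_eq_add, mem_singleton_iff] at hxy ⊢
      linarith
    rw [← measure_vadd volume b K, ← measure_vadd volume a L,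
      ← measure_union₀ (hL.vadd a).measurableSet.nullMeasurableSet hdisj]
    refine measure_mono (union_subset ?_ ?_)
    · rintro _ ⟨x, hx, rfl⟩
      exact ⟨x, hx, b, hbL, add_comm _ _⟩
    · rintro _ ⟨y, hy, rfl⟩
      exact ⟨a, haK, y, hy, rfl⟩
  by_cases hU0 : volume U = 0
  · obtain ⟨u, hu⟩ := hUn
    rw [hU0, zero_add, ← measure_vadd volume u V]
    refine measure_mono ?_
    rintro _ ⟨y, hy, rfl⟩
    exact ⟨u, hu, y, hy, rfl⟩
  by_cases hV0 : volume V = 0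
  · obtain ⟨v, hv⟩ := hVn
    rw [hV0, add_zero, ← measure_vadd volume v U]
    refine measure_mono ?_
    rintro _ ⟨y, hy, rfl⟩
    exact ⟨y, hy, v, hv, add_comm _ _⟩
  refine le_of_forall_lt fun c hc => ?_
  obtain ⟨r, hr, s, hs, hrs⟩ := ENNReal.exists_lt_add_of_lt_add hc hU0 hV0
  obtain ⟨K, hKU, hK, hrK⟩ := hU.exists_lt_isCompact hr
  obtain ⟨L, hLV, hL, hsL⟩ := hV.exists_lt_isCompact hs
  have hKn : K.Nonempty := nonempty_of_measure_ne_zero (ne_bot_of_gt hrK)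
  have hLn : L.Nonempty := nonempty_of_measure_ne_zero (ne_bot_of_gt hsL)
  calc c < r + s := hrs
    _ ≤ volume K + volume L := add_le_add hrK.le hsL.le
    _ ≤ volume (K + L) := compact_case hK hL hKn hLn
    _ ≤ volume (U + V) := measure_mono (Set.add_subset_add hKU hLV)

/-- Functional form: if `H (x + y)` dominates any common lower bound of `F x` and `G y`, and `F`,
`G` take values in `[0, 1]` with supremum `1`, then `∫ F + ∫ G ≤ ∫ H`. -/
theorem lintegral_add_lintegral_le_of_min_le {F G H : ℝ → ℝ} (hF : Measurable F)
    (hG : Measurable G) (hH : Measurable H) (hF0 : ∀ x, 0 ≤ F x) (hG0 : ∀ x, 0 ≤ G x)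
    (hH0 : ∀ x, 0 ≤ H x) (hF1 : IsLUB (range F) 1) (hG1 : IsLUB (range G) 1)
    (h : ∀ x y t, 0 < t → t < F x → t < G y → t < H (x + y)) :
    (∫⁻ x, ENNReal.ofReal (F x)) + ∫⁻ x, ENNReal.ofReal (G x) ≤
      ∫⁻ x, ENNReal.ofReal (H x) := by
  rw [lintegral_eq_lintegral_meas_lt _ (.of_forall hF0) hF.aemeasurable,
    lintegral_eq_lintegral_meas_lt _ (.of_forall hG0) hG.aemeasurable,
    lintegral_eq_lintegral_meas_lt _ (.of_forall hH0) hH.aemeasurable,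
    ← lintegral_add_left]
  swap
  · exact Antitone.measurable fun s t hst => measure_mono fun x hx => lt_of_le_of_lt hst hx
  refine setLIntegral_mono' measurableSet_Ioi fun t ht => ?_
  rcases lt_or_ge t 1 with ht1 | ht1
  · obtain ⟨_, ⟨x, rfl⟩, hx⟩ := (lt_isLUB_iff hF1).1 ht1
    obtain ⟨_, ⟨y, rfl⟩, hy⟩ := (lt_isLUB_iff hG1).1 ht1
    refine (Real.volume_add_le_volume_add (measurableSet_lt measurable_const hF)
      (measurableSet_lt measurable_const hG) ⟨x, hx⟩ ⟨y, hy⟩).trans (measure_mono ?_)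
    rintro _ ⟨x, hx, y, hy, rfl⟩
    exact h x y t ht hx hy
  · have e1 : {x | t < F x} = ∅ :=
      eq_empty_of_forall_notMem fun x hx => (hx.trans_le (hF1.1 ⟨x, rfl⟩)).not_ge ht1
    have e2 : {x | t < G x} = ∅ :=
      eq_empty_of_forall_notMem fun x hx => (hx.trans_le (hG1.1 ⟨x, rfl⟩)).not_ge ht1
    simp [e1, e2]

theorem Bornology.IsBounded.exists_volume_section_le {A : Set (ℝ × ℝ)}
    (hA : Bornology.IsBounded A) : ∃ R : ℝ, ∀ x, volume (Prod.mk x ⁻¹' A) ≤ ENNReal.ofReal R := by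
  obtain ⟨R, hR⟩ := hA.subset_closedBall 0
  refine ⟨2 * R, fun x => ?_⟩
  rw [← Real.volume_closedBall 0 R]
  refine measure_mono fun y hy => ?_
  have := hR hy
  simp only [mem_closedBall, dist_zero_right, Prod.norm_def] at this ⊢
  exact (le_max_right _ _).trans this

/-- Normalized section lengths of a bounded planar set of positive measure. -/
theorem exists_isLUB_volume_section {A : Set (ℝ × ℝ)} (hA : MeasurableSet A)
    (hAb : Bornology.IsBounded A) (hA0 : volume A ≠ 0) :
    ∃ M : ℝ, 0 < M ∧ IsLUB (range fun x => volume.real (Prod.mk x ⁻¹' A) / M) 1 := by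
  obtain ⟨R, hR⟩ := hAb.exists_volume_section_le
  have hbdd : BddAbove (range fun x => volume.real (Prod.mk x ⁻¹' A)) := by
    refine ⟨(ENNReal.ofReal R).toReal, ?_⟩
    rintro _ ⟨x, rfl⟩
    exact ENNReal.toReal_mono ENNReal.ofReal_ne_top (hR x)
  obtain ⟨M, hM⟩ := Real.exists_isLUB (range_nonempty _) hbdd
  have hM0 : 0 < M := by
    by_contra! hM0
    apply hA0
    rw [Measure.volume_eq_prod, Measure.prod_apply hA]
    refine (lintegral_congr fun x => ?_).trans lintegral_zero
    have h1 : volume.real (Prod.mk x ⁻¹' A) ≤ M := hM.1 ⟨x, rfl⟩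
    have h2 : volume.real (Prod.mk x ⁻¹' A) = 0 := le_antisymm (h1.trans hM0) measureReal_nonneg
    exact (measureReal_eq_zero_iff ((hR x).trans_lt ENNReal.ofReal_lt_top).ne).1 h2
  refine ⟨M, hM0, ?_, ?_⟩
  · rintro _ ⟨x, rfl⟩
    exact (div_le_one hM0).2 (hM.1 ⟨x, rfl⟩)
  · intro b hb
    have : M ≤ b * M := hM.2 (by
      rintro _ ⟨x, rfl⟩
      exact (div_le_iff₀ hM0).1 (hb ⟨x, rfl⟩))
    nlinarith

theorem lintegral_ofReal_volume_section_div {A : Set (ℝ × ℝ)} (hA : MeasurableSet A)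
    (hAb : Bornology.IsBounded A) {M : ℝ} (hM : 0 < M) :
    ∫⁻ x, ENNReal.ofReal (volume.real (Prod.mk x ⁻¹' A) / M) =
      ENNReal.ofReal (volume.real A / M) := by
  obtain ⟨R, hR⟩ := hAb.exists_volume_section_le
  have key : ∀ x, ENNReal.ofReal (volume.real (Prod.mk x ⁻¹' A) / M) =
      volume (Prod.mk x ⁻¹' A) / ENNReal.ofReal M := fun x => by
    rw [ENNReal.ofReal_div_of_pos hM,
      ofReal_measureReal ((hR x).trans_lt ENNReal.ofReal_lt_top).ne]
  simp_rw [key, div_eq_mul_inv]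
  rw [lintegral_mul_const _ (measurable_measure_prodMk_left hA), ← Measure.prod_apply hA,
    ← Measure.volume_eq_prod, ← div_eq_mul_inv, ← div_eq_mul_inv, ENNReal.ofReal_div_of_pos hM,
    ofReal_measureReal hAb.measure_lt_top.ne]

/-- Planar Brunn–Minkowski inequality. -/
theorem sqrt_add_sqrt_sq_le_volume_add {A B : Set (ℝ × ℝ)} (hA : IsOpen A) (hB : IsOpen B)
    (hAb : Bornology.IsBounded A) (hBb : Bornology.IsBounded B) (hAn : A.Nonempty)
    (hBn : B.Nonempty) :
    (√(volume.real A) + √(volume.real B)) ^ 2 ≤ volume.real (A + B) := by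
  have hS : IsOpen (A + B) := hA.add_right
  have hSb : Bornology.IsBounded (A + B) := hAb.add hBb
  obtain ⟨M, hM, hM1⟩ := exists_isLUB_volume_section hA.measurableSet hAb (hA.measure_pos _ hAn).ne'
  obtain ⟨N, hN, hN1⟩ := exists_isLUB_volume_section hB.measurableSet hBb (hB.measure_pos _ hBn).ne'
  have hmeas : ∀ {C : Set (ℝ × ℝ)} (c : ℝ), IsOpen C →
      Measurable fun x => volume.real (Prod.mk x ⁻¹' C) / c := fun c hC =>
    (measurable_measure_prodMk_left hC.measurableSet).ennreal_toReal.div_const c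
  have key := lintegral_add_lintegral_le_of_min_le (hmeas M hA) (hmeas N hB)
    (hmeas (M + N) hS) (fun x => by positivity) (fun x => by positivity)
    (fun x => by positivity) hM1 hN1 (by
      intro x y t ht hx hy
      rw [lt_div_iff₀ hM] at hx
      rw [lt_div_iff₀ hN] at hy
      rw [lt_div_iff₀ (by positivity)]
      have hx0 : volume (Prod.mk x ⁻¹' A) ≠ 0 := fun h0 => by
        rw [measureReal_def, h0] at hx
        exact hx.not_ge (by simpa using (mul_pos ht hM).le)
      have hy0 : volume (Prod.mk y ⁻¹' B) ≠ 0 := fun h0 => by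
        rw [measureReal_def, h0] at hy
        exact hy.not_ge (by simpa using (mul_pos ht hN).le)
      have h1 := Real.volume_add_le_volume_add (hA.preimage (Continuous.prodMk_right x)).measurableSet
        (hB.preimage (Continuous.prodMk_right y)).measurableSet
        (nonempty_of_measure_ne_zero hx0) (nonempty_of_measure_ne_zero hy0)
      have h2 : Prod.mk x ⁻¹' A + Prod.mk y ⁻¹' B ⊆ Prod.mk (x + y) ⁻¹' (A + B) := by
        rintro _ ⟨a, ha, b, hb, rfl⟩
        exact ⟨(x, a), ha, (y, b), hb, rfl⟩
      obtain ⟨R, hR⟩ := hSb.exists_volume_section_le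
      obtain ⟨R1, hR1⟩ := hAb.exists_volume_section_le
      obtain ⟨R2, hR2⟩ := hBb.exists_volume_section_le
      have h3 := ENNReal.toReal_mono ((hR (x + y)).trans_lt ENNReal.ofReal_lt_top).ne
        (h1.trans (measure_mono h2))
      rw [ENNReal.toReal_add ((hR1 x).trans_lt ENNReal.ofReal_lt_top).ne
        ((hR2 y).trans_lt ENNReal.ofReal_lt_top).ne] at h3
      simp only [measureReal_def] at hx hy ⊢
      linarith)
  rw [lintegral_ofReal_volume_section_div hA.measurableSet hAb hM,
    lintegral_ofReal_volume_section_div hB.measurableSet hBb hN,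
    lintegral_ofReal_volume_section_div hS.measurableSet hSb (by positivity),
    ← ENNReal.ofReal_add (by positivity) (by positivity),
    ENNReal.ofReal_le_ofReal_iff (by positivity), le_div_iff₀ (by positivity)] at key
  refine le_trans ?_ key
  have hx := Real.sq_sqrt (measureReal_nonneg (μ := volume) (s := A))
  have hy := Real.sq_sqrt (measureReal_nonneg (μ := volume) (s := B))
  set x := √(volume.real A)
  set y := √(volume.real B)
  rw [← hx, ← hy]
  have : (x ^ 2 / M + y ^ 2 / N) * (M + N) - (x + y) ^ 2 = (x * N - y * M) ^ 2 / (M * N) := by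
    field_simp
    ring
  nlinarith [show 0 ≤ (x * N - y * M) ^ 2 / (M * N) by positivity]

/-- Minkowski-type isoperimetric inequality for thickenings in the Euclidean plane. -/
theorem sqrt_volume_add_le_volume_thickening {A : Set (EuclideanSpace ℝ (Fin 2))} (hA : IsOpen A)
    (hAb : Bornology.IsBounded A) (hAn : A.Nonempty) {ε : ℝ} (hε : 0 < ε) :
    (√(volume.real A) + ε * √Real.pi) ^ 2 ≤ volume.real (thickening ε A) := by
  let e : EuclideanSpace ℝ (Fin 2) ≃L[ℝ] ℝ × ℝ :=
    (EuclideanSpace.equiv (Fin 2) ℝ).trans (ContinuousLinearEquiv.finTwoArrow ℝ ℝ)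
  have he : MeasurePreserving e volume volume :=
    (volume_preserving_finTwoArrow ℝ).comp (PiLp.volume_preserving_ofLp (Fin 2))
  have hpre : ∀ C : Set (EuclideanSpace ℝ (Fin 2)), IsOpen C →
      volume.real (e '' C) = volume.real C := fun C hC => by
    rw [measureReal_def, ← he.measure_preimage (e.isOpenMap C hC).measurableSet.nullMeasurableSet,
      e.injective.preimage_image, measureReal_def]
  have hadd : e '' thickening ε A = e '' A + e '' ball 0 ε := by
    rw [← Set.image_add, add_ball_zero]
  have hbdd : ∀ C : Set (EuclideanSpace ℝ (Fin 2)), Bornology.IsBounded C →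
      Bornology.IsBounded (e '' C) := fun C hC =>
    e.lipschitz.isBounded_image hC
  have h := sqrt_add_sqrt_sq_le_volume_add (e.isOpenMap _ hA)
    (e.isOpenMap _ (isOpen_ball (x := 0) (ε := ε)))
    (hbdd _ hAb) (hbdd _ isBounded_ball) (hAn.image e) ((nonempty_ball.2 hε).image e)
  rw [← hadd, hpre _ hA, hpre _ isOpen_ball, hpre _ isOpen_thickening] at h
  have hball : volume.real (ball (0 : EuclideanSpace ℝ (Fin 2)) ε) = ε ^ 2 * Real.pi := by
    rw [measureReal_def, EuclideanSpace.volume_ball_fin_two, ENNReal.toReal_mul,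
      ENNReal.toReal_pow, ENNReal.toReal_ofReal hε.le, ENNReal.toReal_ofReal Real.pi_pos.le]
  rwa [hball, Real.sqrt_mul (by positivity), Real.sqrt_sq hε.le] at h

theorem sub_le_of_norm_fderiv_sub_le {E : Type*} [NormedAddCommGroup E] [NormedSpace ℝ E]
    {v : E → ℝ} (hv : Differentiable ℝ v) {x y : E} {ε δ : ℝ} (hδ : 0 ≤ δ)
    (h : ∀ z ∈ ball x ε, ‖fderiv ℝ v z - fderiv ℝ v x‖ ≤ δ) (hy : y ∈ ball x ε) :
    v y ≤ v x + ε * (‖fderiv ℝ v x‖ + δ) := by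
  have hε : 0 < ε := pos_of_mem_ball hy
  have h1 := (convex_ball x ε).norm_image_sub_le_of_norm_fderiv_le'
    (fun z _ => hv z) h (mem_ball_self hε) hy
  have h2 : ‖y - x‖ ≤ ε := by rw [← dist_eq_norm]; exact (mem_ball.1 hy).le
  have h3 := (le_abs_self _).trans ((fderiv ℝ v x).le_opNorm (y - x))
  have h4 := (le_abs_self _).trans h1
  have h5 := mul_le_mul_of_nonneg_left h2 (norm_nonneg (fderiv ℝ v x))
  have h6 := mul_le_mul_of_nonneg_left h2 hδ
  linarith

/-- Sharp capacity-type consequence of the isoperimetric inequality: `∫ |∇v|` controls the measure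
of the superlevel sets of `v`. -/
theorem two_sqrt_pi_mul_le_integral_norm_fderiv {v : EuclideanSpace ℝ (Fin 2) → ℝ}
    (hv : ContDiff ℝ 1 v) (hvc : HasCompactSupport v) (hv0 : ∀ x, 0 ≤ v x) {c : ℝ} (hc : 0 < c) :
    2 * √Real.pi * c * √(volume.real {x | c ≤ v x}) ≤ ∫ x, ‖fderiv ℝ v x‖ := by
  have hvcont := hv.continuous
  have hdcont := hv.continuous_fderiv one_ne_zero
  have hdc := hvc.fderiv (𝕜 := ℝ)
  have hvi : Integrable v := hvcont.integrable_of_hasCompactSupport hvc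
  have hdi : Integrable fun x => ‖fderiv ℝ v x‖ :=
    (hdcont.integrable_of_hasCompactSupport hdc).norm
  have hbdd : ∀ t, 0 < t → Bornology.IsBounded {x | t ≤ v x} := fun t ht =>
    hvc.isBounded.subset fun x hx =>
      subset_tsupport v (ne_of_gt (ht.trans_le hx))
  set S := volume.real {x | c ≤ v x} with hS
  set K := cthickening 1 (tsupport v) with hK
  have hKc : IsCompact K := hvc.isCompact.cthickening
  refine le_of_forall_pos_le_add fun η hη => ?_
  obtain ⟨δ, hδ, hδη⟩ : ∃ δ > 0, δ * volume.real K ≤ η := by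
    refine ⟨η / (volume.real K + 1), by positivity, ?_⟩
    rw [div_mul_eq_mul_div, div_le_iff₀ (by positivity)]
    nlinarith [measureReal_nonneg (μ := volume) (s := K)]
  obtain ⟨ε₀, hε₀, huc⟩ := Metric.uniformContinuous_iff.1
    (hdc.uniformContinuous_of_continuous hdcont) δ hδ
  set ε := min ε₀ 1 with hε
  have hε0 : 0 < ε := lt_min hε₀ one_pos
  let W : EuclideanSpace ℝ (Fin 2) → ℝ := fun x =>
    v x + ε * (‖fderiv ℝ v x‖ + K.indicator (fun _ => δ) x)
  have hind : Integrable (K.indicator fun _ : EuclideanSpace ℝ (Fin 2) => δ) :=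
    (integrable_indicator_iff hKc.measurableSet).2 (integrableOn_const hKc.measure_lt_top.ne)
  have hsi : Integrable fun x => ‖fderiv ℝ v x‖ + K.indicator (fun _ => δ) x := hdi.add hind
  have hWi : Integrable W := hvi.add (hsi.const_mul ε)
  have hind0 : ∀ x, 0 ≤ K.indicator (fun _ => δ) x := fun x => indicator_nonneg (fun _ _ => hδ.le) x
  have hW0 : ∀ x, 0 ≤ W x := fun x =>
    add_nonneg (hv0 x) (mul_nonneg hε0.le (add_nonneg (norm_nonneg _) (hind0 x)))
  have hWle : ∀ x, ∀ y ∈ ball x ε, v y ≤ W x := by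
    intro x y hy
    by_cases hx : x ∈ K
    · simp only [W, indicator_of_mem hx]
      refine sub_le_of_norm_fderiv_sub_le (hv.differentiable one_ne_zero) hδ.le
        (fun z hz => ?_) hy
      rw [← dist_eq_norm]
      exact (huc ((mem_ball.1 hz).trans_le (min_le_left _ _))).le
    · have : y ∉ tsupport v := fun hy' => hx <| mem_cthickening_of_dist_le x y 1 _ hy' <| by
        rw [dist_comm]
        exact ((mem_ball.1 hy).trans_le (min_le_right _ _)).le
      rw [image_eq_zero_of_notMem_tsupport this]
      exact hW0 x
  have hlow : ∀ t ∈ Ioi (0 : ℝ), volume {x | t < v x} +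
      (Iio c).indicator (fun _ => ENNReal.ofReal (2 * ε * √Real.pi * √S)) t ≤
        volume {x | t < W x} := by
    intro t ht
    have hbt : Bornology.IsBounded {x | t < v x} := (hbdd t ht).subset fun x (hx : t < v x) => hx.le
    have hsub : thickening ε {x | t < v x} ⊆ {x | t < W x} := by
      intro x hx
      obtain ⟨y, hy, hxy⟩ := mem_thickening_iff.1 hx
      exact lt_of_lt_of_le hy (hWle x y (by rwa [mem_ball, dist_comm]))
    refine le_trans ?_ (measure_mono hsub)
    by_cases htc : t < c
    swap
    · rw [indicator_of_notMem (by simpa using htc), add_zero]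
      exact measure_mono (self_subset_thickening hε0 _)
    rw [indicator_of_mem (by simpa using htc)]
    have hSt : S ≤ volume.real {x | t < v x} :=
      measureReal_mono (fun x hx => lt_of_lt_of_le htc hx) hbt.measure_lt_top.ne
    rcases {x | t < v x}.eq_empty_or_nonempty with he | hne
    · have : S = 0 := le_antisymm (by simpa [he] using hSt) measureReal_nonneg
      simp [he, this]
    have h1 := sqrt_volume_add_le_volume_thickening (isOpen_lt continuous_const hvcont) hbt hne hε0
    rw [← ofReal_measureReal hbt.measure_lt_top.ne,
      ← ofReal_measureReal hbt.thickening.measure_lt_top.ne,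
      ← ENNReal.ofReal_add measureReal_nonneg (by positivity)]
    refine ENNReal.ofReal_le_ofReal (le_trans ?_ h1)
    have h2 := Real.sq_sqrt (measureReal_nonneg (μ := volume) (s := {x | t < v x}))
    have h3 := mul_le_mul_of_nonneg_left (Real.sqrt_le_sqrt hSt)
      (by positivity : 0 ≤ 2 * ε * √Real.pi)
    nlinarith [sq_nonneg (ε * √Real.pi)]
  have hint : ENNReal.ofReal (∫ x, v x) + ENNReal.ofReal (2 * ε * √Real.pi * √S * c) ≤
      ENNReal.ofReal (∫ x, W x) := by
    rw [ofReal_integral_eq_lintegral_ofReal hvi (.of_forall hv0),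
      ofReal_integral_eq_lintegral_ofReal hWi (.of_forall hW0),
      lintegral_eq_lintegral_meas_lt _ (.of_forall hv0) hvi.aemeasurable,
      lintegral_eq_lintegral_meas_lt _ (.of_forall hW0) hWi.aemeasurable]
    refine le_trans (le_of_eq ?_) (setLIntegral_mono' measurableSet_Ioi hlow)
    rw [lintegral_add_right _ (measurable_const.indicator measurableSet_Iio),
      lintegral_indicator_const measurableSet_Iio, Measure.restrict_apply measurableSet_Iio,
      inter_comm, Ioi_inter_Iio, Real.volume_Ioo, sub_zero, ENNReal.ofReal_mul (by positivity)]
  rw [← ENNReal.ofReal_add (integral_nonneg hv0) (by positivity),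
    ENNReal.ofReal_le_ofReal_iff (integral_nonneg hW0)] at hint
  have hWint : ∫ x, W x = (∫ x, v x) + ε * ((∫ x, ‖fderiv ℝ v x‖) + volume.real K * δ) := by
    rw [integral_add hvi (hsi.const_mul ε), integral_const_mul,
      integral_add hdi hind, integral_indicator_const _ hKc.measurableSet, smul_eq_mul]
  rw [hWint] at hint
  have : ε * (2 * √Real.pi * c * √S) ≤ ε * ((∫ x, ‖fderiv ℝ v x‖) + volume.real K * δ) := by
    linarith
  have := le_of_mul_le_mul_left this hε0
  linarith

section Truncation

variable {N : ℕ} {Ω : Set (EuclideanSpace ℝ (Fin N))} {u : EuclideanSpace ℝ (Fin N) → ℝ}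
  {G : ℝ → ℝ} {s : ℝ}

theorem isCompact_closure_inter_le (hΩb : Bornology.IsBounded Ω) (hu : Continuous u) :
    IsCompact (closure Ω ∩ {x | s ≤ u x}) :=
  hΩb.isCompact_closure.inter_right (isClosed_le continuous_const hu)

theorem closure_inter_le_subset (hΩ : IsOpen Ω) (hu0 : ∀ x ∈ frontier Ω, u x ≤ 0) (hs : 0 < s) :
    closure Ω ∩ {x | s ≤ u x} ⊆ Ω := by
  rintro x ⟨hx, hsx⟩
  by_contra hxΩ
  have : x ∈ frontier Ω := ⟨hx, by rwa [hΩ.interior_eq]⟩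
  exact (hs.trans_le hsx).not_ge (hu0 x this)

theorem indicator_comp_eq_zero (hG : ∀ r ≤ s, G r = 0) {x : EuclideanSpace ℝ (Fin N)}
    (hx : x ∉ closure Ω ∩ {x | s ≤ u x}) : Ω.indicator (fun x => G (u x)) x = 0 := by
  by_cases hxΩ : x ∈ Ω
  · rw [indicator_of_mem hxΩ]
    refine hG _ (not_le.1 fun h => hx ⟨subset_closure hxΩ, h⟩).le
  · exact indicator_of_notMem hxΩ _

theorem hasCompactSupport_indicator_comp (hΩb : Bornology.IsBounded Ω) (hu : Continuous u)
    (hG : ∀ r ≤ s, G r = 0) : HasCompactSupport (Ω.indicator fun x => G (u x)) :=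
  HasCompactSupport.intro (isCompact_closure_inter_le hΩb hu) fun _ => indicator_comp_eq_zero hG

theorem tsupport_indicator_comp_subset (hΩ : IsOpen Ω) (hΩb : Bornology.IsBounded Ω)
    (hu : Continuous u) (hu0 : ∀ x ∈ frontier Ω, u x ≤ 0) (hs : 0 < s) (hG : ∀ r ≤ s, G r = 0) :
    tsupport (Ω.indicator fun x => G (u x)) ⊆ Ω := by
  refine subset_trans ?_ (closure_inter_le_subset hΩ hu0 hs)
  refine closure_minimal (fun x hx => ?_) (isCompact_closure_inter_le hΩb hu).isClosed
  by_contra h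
  exact hx (indicator_comp_eq_zero hG h)

theorem contDiff_indicator_comp (hΩ : IsOpen Ω) (hΩb : Bornology.IsBounded Ω)
    (hu : ContDiff ℝ 1 u) (hu0 : ∀ x ∈ frontier Ω, u x ≤ 0) (hs : 0 < s) (hG : ∀ r ≤ s, G r = 0)
    (hGd : ContDiff ℝ 1 G) : ContDiff ℝ 1 (Ω.indicator fun x => G (u x)) := by
  refine contDiff_iff_contDiffAt.2 fun x => ?_
  by_cases hx : x ∈ Ω
  · refine (hGd.comp hu).contDiffAt.congr_of_eventuallyEq ?_
    filter_upwards [hΩ.mem_nhds hx] with y hy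
    exact indicator_of_mem hy _
  · have hx' : x ∈ (tsupport (Ω.indicator fun x => G (u x)))ᶜ := fun h =>
      hx (tsupport_indicator_comp_subset hΩ hΩb hu.continuous hu0 hs hG h)
    refine contDiffAt_const (c := (0 : ℝ)) |>.congr_of_eventuallyEq ?_
    filter_upwards [(isClosed_tsupport _).isOpen_compl.mem_nhds hx'] with y hy
    exact image_eq_zero_of_notMem_tsupport hy

theorem fderiv_indicator_comp_of_mem (hΩ : IsOpen Ω) (hu : Differentiable ℝ u)
    (hGd : Differentiable ℝ G) {x : EuclideanSpace ℝ (Fin N)} (hx : x ∈ Ω) :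
    fderiv ℝ (Ω.indicator fun x => G (u x)) x = deriv G (u x) • fderiv ℝ u x := by
  have h : Ω.indicator (fun x => G (u x)) =ᶠ[nhds x] G ∘ u := by
    filter_upwards [hΩ.mem_nhds hx] with y hy
    exact indicator_of_mem hy _
  rw [h.fderiv_eq]
  exact ((hGd (u x)).hasDerivAt.comp_hasFDerivAt x (hu x).hasFDerivAt).fderiv

theorem fderiv_indicator_comp_of_notMem (hΩ : IsOpen Ω) (hΩb : Bornology.IsBounded Ω)
    (hu : Continuous u) (hu0 : ∀ x ∈ frontier Ω, u x ≤ 0) (hs : 0 < s) (hG : ∀ r ≤ s, G r = 0)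
    {x : EuclideanSpace ℝ (Fin N)} (hx : x ∉ Ω) :
    fderiv ℝ (Ω.indicator fun x => G (u x)) x = 0 := by
  by_contra h
  exact hx (tsupport_indicator_comp_subset hΩ hΩb hu hu0 hs hG
    (support_fderiv_subset ℝ h))

theorem norm_sq_eq_sum_apply_single (L : StrongDual ℝ (EuclideanSpace ℝ (Fin N))) :
    ‖L‖ ^ 2 = ∑ i, L (EuclideanSpace.single i (1 : ℝ)) ^ 2 := by
  simpa using (EuclideanSpace.basisFun (Fin N) ℝ).norm_dual L

/-- Green's formula for a compactly supported test function. -/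
theorem integral_sum_fderiv_mul_fderiv {w : EuclideanSpace ℝ (Fin N) → ℝ} (hw : ContDiff ℝ 1 w)
    (hwc : HasCompactSupport w) (hu : ContDiff ℝ 2 u) :
    ∫ x, ∑ i, fderiv ℝ w x (EuclideanSpace.single i 1) * fderiv ℝ u x (EuclideanSpace.single i 1) =
      ∫ x, w x * -lapl u x := by
  have hu1 : ∀ i : Fin N, ContDiff ℝ 1 fun y => fderiv ℝ u y (EuclideanSpace.single i (1 : ℝ)) :=
    fun i => (hu.fderiv_right (m := 1) le_rfl).clm_apply contDiff_const
  have hdw : ∀ i : Fin N, Continuous fun y => fderiv ℝ w y (EuclideanSpace.single i (1 : ℝ)) :=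
    fun i => (hw.continuous_fderiv one_ne_zero).clm_apply continuous_const
  have hddu : ∀ i : Fin N, Continuous fun x =>
      fderiv ℝ (fun y => fderiv ℝ u y (EuclideanSpace.single i (1 : ℝ))) x
        (EuclideanSpace.single i (1 : ℝ)) :=
    fun i => ((hu1 i).continuous_fderiv one_ne_zero).clm_apply continuous_const
  have hdwc : ∀ i : Fin N, HasCompactSupport
      fun y => fderiv ℝ w y (EuclideanSpace.single i (1 : ℝ)) := fun i => hwc.fderiv_apply ℝ _
  have hi1 : ∀ i : Fin N, Integrable fun x => fderiv ℝ w x (EuclideanSpace.single i 1) *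
      fderiv ℝ u x (EuclideanSpace.single i 1) := fun i =>
    ((hdw i).mul (hu1 i).continuous).integrable_of_hasCompactSupport (hdwc i).mul_right
  have hi2 : ∀ i : Fin N, Integrable fun x => w x *
      fderiv ℝ (fun y => fderiv ℝ u y (EuclideanSpace.single i (1 : ℝ))) x
        (EuclideanSpace.single i (1 : ℝ)) := fun i =>
    (hw.continuous.mul (hddu i)).integrable_of_hasCompactSupport hwc.mul_right
  rw [integral_finsetSum _ fun i _ => hi1 i]
  simp only [lapl, mul_neg, Finset.mul_sum]
  rw [integral_neg, integral_finsetSum _ fun i _ => hi2 i, ← Finset.sum_neg_distrib]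
  refine Finset.sum_congr rfl fun i _ => ?_
  rw [integral_mul_fderiv_eq_neg_fderiv_mul_of_integrable (hi1 i) (hi2 i)
    ((hw.continuous.mul (hu1 i).continuous).integrable_of_hasCompactSupport hwc.mul_right)
    (fun x _ => hw.differentiable one_ne_zero x)
    (fun x _ => (hu1 i).differentiable one_ne_zero x), neg_neg]

/-- Testing `-Δu` against a truncation `G(u)` with slope in `[0, 1]`. -/
theorem integral_norm_fderiv_indicator_comp_sq_le (hΩ : IsOpen Ω) (hΩb : Bornology.IsBounded Ω)
    (hu : ContDiff ℝ 2 u) (hu0 : ∀ x ∈ frontier Ω, u x ≤ 0) (hs : 0 < s) (hG : ∀ r ≤ s, G r = 0)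
    (hGd : ContDiff ℝ 1 G) (hG0 : ∀ r, 0 ≤ deriv G r) (hG1 : ∀ r, deriv G r ≤ 1) :
    ∫ x, ‖fderiv ℝ (Ω.indicator fun x => G (u x)) x‖ ^ 2 ≤ ∫ x in Ω, G (u x) * -lapl u x := by
  have hu1 : ContDiff ℝ 1 u := hu.of_le one_le_two
  have hwc := hasCompactSupport_indicator_comp hΩb hu.continuous hG
  have hwd := contDiff_indicator_comp hΩ hΩb hu1 hu0 hs hG hGd
  have hmain : ∫ x in Ω, G (u x) * -lapl u x =
      ∫ x, Ω.indicator (fun x => G (u x)) x * -lapl u x := by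
    rw [← integral_indicator hΩ.measurableSet]
    refine integral_congr_ae (.of_forall fun x => ?_)
    simp only [indicator_mul_left]
  rw [hmain, ← integral_sum_fderiv_mul_fderiv hwd hwc hu]
  have hdw := hwd.continuous_fderiv one_ne_zero
  have hdwc := hwc.fderiv (𝕜 := ℝ)
  refine integral_mono ?_ ?_ fun x => ?_
  · refine (hdw.norm.pow 2).integrable_of_hasCompactSupport
      (HasCompactSupport.intro hdwc.isCompact fun x hx => ?_)
    have hx0 := image_eq_zero_of_notMem_tsupport hx
    simp [hx0]
  · refine integrable_finsetSum _ fun i _ => ?_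
    exact ((hdw.clm_apply continuous_const).mul
      ((hu1.continuous_fderiv one_ne_zero).clm_apply
        continuous_const)).integrable_of_hasCompactSupport (hwc.fderiv_apply ℝ _).mul_right
  · simp only [norm_sq_eq_sum_apply_single]
    refine Finset.sum_le_sum fun i _ => ?_
    by_cases hx : x ∈ Ω
    · rw [fderiv_indicator_comp_of_mem hΩ (hu1.differentiable one_ne_zero)
        (hGd.differentiable one_ne_zero) hx]
      simp only [_root_.smul_apply, smul_eq_mul]
      nlinarith [mul_nonneg (mul_nonneg (hG0 (u x)) (sub_nonneg.2 (hG1 (u x))))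
        (sq_nonneg (fderiv ℝ u x (EuclideanSpace.single i 1)))]
    · rw [fderiv_indicator_comp_of_notMem hΩ hΩb hu.continuous hu0 hs hG hx]
      simp

end Truncation

/-- A `C¹` truncation with slope in `[0, 1]`, vanishing below `s` and flat above `t`. -/
theorem exists_truncation {s t c : ℝ} (hst : s < t) (hct : c < t - s) :
    ∃ G : ℝ → ℝ, ContDiff ℝ 1 G ∧ (∀ r, 0 ≤ deriv G r) ∧ (∀ r, deriv G r ≤ 1) ∧
      (∀ r ≤ s, G r = 0) ∧ (∀ r, 0 ≤ G r) ∧ (∀ r, G r ≤ t - s) ∧ (∀ r ≥ t, c ≤ G r) ∧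
      (∀ r ≤ s, deriv G r = 0) ∧ ∀ r ≥ t, deriv G r = 0 := by
  obtain ⟨η, hη, h2η, hηc⟩ : ∃ η > 0, 2 * η < t - s ∧ c ≤ t - s - 2 * η := by
    refine ⟨min ((t - s) / 4) ((t - s - c) / 2), lt_min (by linarith) (by linarith), ?_, ?_⟩
    · linarith [min_le_left ((t - s) / 4) ((t - s - c) / 2)]
    · linarith [min_le_right ((t - s) / 4) ((t - s - c) / 2)]
  let χ : ℝ → ℝ := fun r => max 0 (min 1 (min ((r - s) / η) ((t - r) / η)))
  have hχ : Continuous χ := by fun_prop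
  have hχ0 : ∀ r, 0 ≤ χ r := fun r => le_max_left _ _
  have hχ1 : ∀ r, χ r ≤ 1 := fun r => max_le zero_le_one (min_le_left _ _)
  have hχs : ∀ r ≤ s, χ r = 0 := fun r hr => max_eq_left <| (min_le_right _ _).trans <|
    (min_le_left _ _).trans <| div_nonpos_of_nonpos_of_nonneg (by linarith) hη.le
  have hχt : ∀ r ≥ t, χ r = 0 := fun r hr => max_eq_left <| (min_le_right _ _).trans <|
    (min_le_right _ _).trans <| div_nonpos_of_nonpos_of_nonneg (by linarith) hη.le
  have hχm : ∀ r ∈ Icc (s + η) (t - η), 1 ≤ χ r := fun r hr => le_max_of_le_right <|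
    le_min le_rfl <| le_min ((one_le_div hη).2 (by linarith [hr.1]))
      ((one_le_div hη).2 (by linarith [hr.2]))
  have hχi : ∀ a b, IntervalIntegrable χ volume a b := fun a b => hχ.intervalIntegrable a b
  let G : ℝ → ℝ := fun r => ∫ x in s..r, χ x
  have hGd : ∀ r, HasDerivAt G (χ r) r := fun r => (hχ.integral_hasStrictDerivAt s r).hasDerivAt
  have hder : deriv G = χ := funext fun r => (hGd r).deriv
  have hGs : ∀ r ≤ s, G r = 0 := fun r hr => by
    refine intervalIntegral.integral_zero_ae (.of_forall fun x hx => hχs x ?_)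
    rw [uIoc_of_ge hr] at hx
    exact hx.2
  have hGmono : Monotone G := monotone_of_deriv_nonneg (fun r => (hGd r).differentiableAt)
    (fun r => by rw [hder]; exact hχ0 r)
  have hGt : ∀ r ≥ t, G r = G t := fun r hr => by
    have h1 : ∫ x in t..r, χ x = 0 := by
      refine intervalIntegral.integral_zero_ae (.of_forall fun x hx => hχt x ?_)
      rw [uIoc_of_le hr] at hx
      exact hx.1.le
    have h2 := intervalIntegral.integral_add_adjacent_intervals (hχi s t) (hχi t r)
    simp only [G]
    linarith
  have hGc : c ≤ G t := by
    have h1 : ∫ _ in (s + η)..(t - η), (1 : ℝ) ≤ ∫ x in (s + η)..(t - η), χ x :=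
      intervalIntegral.integral_mono_on (by linarith) (by simp) (hχi _ _) hχm
    have h2 : ∫ x in (s + η)..(t - η), χ x ≤ ∫ x in s..t, χ x :=
      intervalIntegral.integral_mono_interval (by linarith) (by linarith) (by linarith)
        (.of_forall hχ0) (hχi _ _)
    simp only [intervalIntegral.integral_const, smul_eq_mul, mul_one] at h1
    simp only [G]
    linarith
  have hGts : G t ≤ t - s := by
    have h1 : ∫ x in s..t, χ x ≤ ∫ _ in s..t, (1 : ℝ) :=
      intervalIntegral.integral_mono_on hst.le (hχi _ _) (by simp) fun x _ => hχ1 x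
    simpa using h1
  refine ⟨G, contDiff_one_iff_deriv.2 ⟨fun r => (hGd r).differentiableAt, by rwa [hder]⟩,
    fun r => by rw [hder]; exact hχ0 r, fun r => by rw [hder]; exact hχ1 r, hGs, fun r => ?_,
    fun r => ?_, fun r hr => (hGt r hr).symm ▸ hGc, fun r hr => by rw [hder]; exact hχs r hr,
    fun r hr => by rw [hder]; exact hχt r hr⟩
  · rcases le_total r s with hr | hr
    · exact (hGs r hr).ge
    · exact (hGs s le_rfl).ge.trans (hGmono hr)
  · rcases le_total r t with hr | hr
    · exact (hGmono hr).trans hGts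
    · exact (hGt r hr).le.trans hGts

theorem sq_integral_le_measureReal_mul {X : Type*} [MeasurableSpace X] {μ : Measure X}
    {f : X → ℝ} {D : Set X} (hD : MeasurableSet D) (hDf : μ D ≠ ∞) (hf : Integrable f μ)
    (hf2 : Integrable (fun x => f x ^ 2) μ) (h0 : ∀ x ∉ D, f x = 0) :
    (∫ x, f x ∂μ) ^ 2 ≤ μ.real D * ∫ x, f x ^ 2 ∂μ := by
  have hind : Integrable (D.indicator fun _ => (1 : ℝ)) μ :=
    (integrable_indicator_iff hD).2 (integrableOn_const hDf)
  have key : ∀ r : ℝ, 0 ≤ μ.real D * (r * r) + (-2 * ∫ x, f x ∂μ) * r + ∫ x, f x ^ 2 ∂μ := by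
    intro r
    have h1 : 0 ≤ ∫ x, (r * r * D.indicator (fun _ => (1 : ℝ)) x + (-2 * r) * f x + f x ^ 2) ∂μ :=
      integral_nonneg fun x => by
        by_cases hx : x ∈ D
        · rw [Pi.zero_apply, indicator_of_mem hx]
          nlinarith [sq_nonneg (r - f x)]
        · simp [indicator_of_notMem hx, h0 x hx]
    have h2 : Integrable (fun x => r * r * D.indicator (fun _ => (1 : ℝ)) x) μ :=
      hind.const_mul _
    have h3 : Integrable (fun x => (-2 * r) * f x) μ := hf.const_mul _
    have h4 : Integrable (fun x => r * r * D.indicator (fun _ => (1 : ℝ)) x + (-2 * r) * f x) μ :=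
      h2.add h3
    rw [integral_add h4 hf2, integral_add h2 h3, integral_const_mul, integral_const_mul,
      integral_indicator_const _ hD, smul_eq_mul, mul_one] at h1
    linarith
  have := discrim_le_zero key
  rw [discrim] at this
  nlinarith

section Level

variable {Ω : Set (EuclideanSpace ℝ (Fin 2))} {u : EuclideanSpace ℝ (Fin 2) → ℝ}

theorem continuous_lapl {N : ℕ} {u : EuclideanSpace ℝ (Fin N) → ℝ} (hu : ContDiff ℝ 2 u) :
    Continuous (lapl u) :=
  continuous_finsetSum _ fun i _ =>
    ((((hu.fderiv_right (m := 1) le_rfl).clm_apply contDiff_const).continuous_fderiv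
      one_ne_zero).clm_apply continuous_const : Continuous fun x =>
        fderiv ℝ (fun y => fderiv ℝ u y (EuclideanSpace.single i (1 : ℝ))) x
          (EuclideanSpace.single i (1 : ℝ)))

theorem Continuous.integrableOn_of_isBounded {N : ℕ} {f : EuclideanSpace ℝ (Fin N) → ℝ}
    (hf : Continuous f) {S : Set (EuclideanSpace ℝ (Fin N))} (hS : Bornology.IsBounded S) :
    IntegrableOn f S :=
  (hf.continuousOn.integrableOn_compact hS.isCompact_closure).mono_set subset_closure

/-- Integrated form over `(s, t)` of `4π μ(t) ≤ (-μ'(t)) ∫_{u > t} -Δu`, which follows from the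
isoperimetric inequality on level sets. -/
theorem four_pi_mul_measure_superlevel_le (hΩ : IsOpen Ω) (hΩb : Bornology.IsBounded Ω)
    (hu : ContDiff ℝ 2 u) (hu0 : ∀ x ∈ frontier Ω, u x ≤ 0) (hΔ : ∀ x ∈ Ω, 0 ≤ -lapl u x)
    {s t : ℝ} (hs : 0 < s) (hst : s < t) :
    4 * Real.pi * (t - s) * volume.real (Ω ∩ {x | t < u x}) ≤
      (∫ x in Ω ∩ {x | s < u x}, -lapl u x) *
        (volume.real (Ω ∩ {x | s < u x}) - volume.real (Ω ∩ {x | t < u x})) := by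
  set M := ∫ x in Ω ∩ {x | s < u x}, -lapl u x
  have hms : ∀ r, MeasurableSet (Ω ∩ {x | r < u x}) := fun r =>
    hΩ.measurableSet.inter (measurableSet_lt measurable_const hu.continuous.measurable)
  have hfin : ∀ r, volume (Ω ∩ {x | r < u x}) ≠ ∞ := fun r =>
    (hΩb.subset inter_subset_left).measure_lt_top.ne
  have hsub : Ω ∩ {x | t < u x} ⊆ Ω ∩ {x | s < u x} := fun x hx => ⟨hx.1, hst.trans hx.2⟩
  set D := (Ω ∩ {x | s < u x}) \ (Ω ∩ {x | t < u x}) with hDdef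
  have hD : MeasurableSet D := (hms s).diff (hms t)
  have hDfin : volume D ≠ ∞ := measure_ne_top_of_subset sdiff_subset (hfin s)
  have hDvol : volume.real D =
      volume.real (Ω ∩ {x | s < u x}) - volume.real (Ω ∩ {x | t < u x}) :=
    measureReal_sdiff hsub (hms t) (h₁ := hfin s)
  rw [← hDvol]
  have key : ∀ c, 0 < c → c < t - s →
      4 * Real.pi * c ^ 2 * volume.real (Ω ∩ {x | t < u x}) ≤ volume.real D * ((t - s) * M) := by
    intro c hc hct
    obtain ⟨G, hGd, hG'0, hG'1, hGs, hG0, hGts, hGt, hG's, hG't⟩ := exists_truncation hst hct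
    have hwc := hasCompactSupport_indicator_comp hΩb hu.continuous hGs
    have hwd := contDiff_indicator_comp hΩ hΩb (hu.of_le one_le_two) hu0 hs hGs hGd
    have henergy := integral_norm_fderiv_indicator_comp_sq_le hΩ hΩb hu hu0 hs hGs hGd hG'0 hG'1
    have hfmem : ∀ x ∈ Ω, fderiv ℝ (Ω.indicator fun x => G (u x)) x =
        deriv G (u x) • fderiv ℝ u x := fun x hx =>
      fderiv_indicator_comp_of_mem hΩ (hu.differentiable two_ne_zero)
        (hGd.differentiable one_ne_zero) hx
    have hfnot : ∀ x ∉ Ω, fderiv ℝ (Ω.indicator fun x => G (u x)) x = 0 := fun x hx =>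
      fderiv_indicator_comp_of_notMem hΩ hΩb hu.continuous hu0 hs hGs hx
    have hwge : Ω ∩ {x | t < u x} ⊆ {x | c ≤ Ω.indicator (fun x => G (u x)) x} := by
      rintro x ⟨hx, htx⟩
      rw [mem_ofPred_eq, indicator_of_mem hx]
      exact hGt _ (le_of_lt htx)
    have hwle : {x | c ≤ Ω.indicator (fun x => G (u x)) x} ⊆ Ω := by
      intro x hx
      by_contra hxΩ
      rw [mem_ofPred_eq, indicator_of_notMem hxΩ] at hx
      linarith
    have hw0 : ∀ x, 0 ≤ Ω.indicator (fun x => G (u x)) x := fun x =>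
      indicator_nonneg (fun x _ => hG0 _) x
    generalize (Ω.indicator fun x => G (u x)) = w at *
    have hiso := two_sqrt_pi_mul_le_integral_norm_fderiv hwd hwc hw0 hc
    have hfc := hwd.continuous_fderiv one_ne_zero
    have hfcs := hwc.fderiv (𝕜 := ℝ)
    have hCS := sq_integral_le_measureReal_mul (f := fun x => ‖fderiv ℝ w x‖) hD hDfin
      (hfc.integrable_of_hasCompactSupport hfcs).norm
      ((hfc.norm.pow 2).integrable_of_hasCompactSupport
        (HasCompactSupport.intro hfcs.isCompact fun x hx => by
          have hx0 := image_eq_zero_of_notMem_tsupport hx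
          simp [hx0]))
      (fun x hx => by
        by_cases hxΩ : x ∈ Ω
        · rw [hfmem x hxΩ]
          rcases le_or_gt (u x) s with hxs | hxs
          · simp [hG's _ hxs]
          rcases lt_or_ge t (u x) with hxt | hxt
          · simp [hG't _ hxt.le]
          · exact absurd ⟨⟨hxΩ, hxs⟩, fun h => h.2.not_ge hxt⟩ hx
        · simp [hfnot x hxΩ])
    have hG_le : ∫ x in Ω, G (u x) * -lapl u x ≤ (t - s) * M := by
      have h1 : ∫ x in Ω, G (u x) * -lapl u x =
          ∫ x in Ω ∩ {x | s < u x}, G (u x) * -lapl u x := by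
        refine setIntegral_eq_of_subset_of_forall_sdiff_eq_zero hΩ.measurableSet
          inter_subset_left fun x hx => ?_
        rw [hGs _ (not_lt.1 fun h => hx.2 ⟨hx.1, h⟩), zero_mul]
      rw [h1, ← integral_const_mul]
      have hb : Bornology.IsBounded (Ω ∩ {x | s < u x}) := hΩb.subset inter_subset_left
      refine setIntegral_mono_on
        (((hGd.continuous.comp hu.continuous).mul
          (continuous_lapl hu).neg).integrableOn_of_isBounded hb)
        ((continuous_const.mul (continuous_lapl hu).neg).integrableOn_of_isBounded hb)
        (hms s) fun x hx => ?_
      exact mul_le_mul_of_nonneg_right (hGts _) (hΔ x hx.1)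
    have hvol : volume.real (Ω ∩ {x | t < u x}) ≤ volume.real {x | c ≤ w x} :=
      measureReal_mono hwge (hΩb.subset hwle).measure_lt_top.ne
    calc 4 * Real.pi * c ^ 2 * volume.real (Ω ∩ {x | t < u x})
        ≤ 4 * Real.pi * c ^ 2 * volume.real {x | c ≤ w x} := by gcongr
      _ = (2 * √Real.pi * c * √(volume.real {x | c ≤ w x})) ^ 2 := by
        rw [mul_pow, mul_pow, mul_pow, Real.sq_sqrt Real.pi_pos.le, Real.sq_sqrt measureReal_nonneg]
        ring
      _ ≤ (∫ x, ‖fderiv ℝ w x‖) ^ 2 := by gcongr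
      _ ≤ volume.real D * ∫ x, ‖fderiv ℝ w x‖ ^ 2 := hCS
      _ ≤ volume.real D * ((t - s) * M) := by
        gcongr
        exact henergy.trans hG_le
  have hlim : 4 * Real.pi * (t - s) ^ 2 * volume.real (Ω ∩ {x | t < u x}) ≤
      volume.real D * ((t - s) * M) := by
    have hcont : Filter.Tendsto
        (fun c : ℝ => 4 * Real.pi * c ^ 2 * volume.real (Ω ∩ {x | t < u x}))
        (nhdsWithin (t - s) (Iio (t - s)))
        (nhds (4 * Real.pi * (t - s) ^ 2 * volume.real (Ω ∩ {x | t < u x}))) :=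
      ((by fun_prop : Continuous fun c : ℝ =>
        4 * Real.pi * c ^ 2 * volume.real (Ω ∩ {x | t < u x})).tendsto (t - s)).mono_left
          nhdsWithin_le_nhds
    refine le_of_tendsto hcont ?_
    filter_upwards [Ioo_mem_nhdsLT (sub_pos.2 hst)] with c hc
    exact key c hc.1 hc.2
  refine le_of_mul_le_mul_left ?_ (sub_pos.2 hst)
  linarith

end Level

/-- Differential form of a decay estimate for an antitone function. -/
theorem ae_le_deriv_neg_sq_of_antitone {m φ : ℝ → ℝ} {κ p : ℝ} (hm : Antitone m)
    (h : ∀ s t, 0 < s → s < t → (t - s) * s ^ p * φ t ≤ κ * (m s * (m s - m t))) :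
    ∀ᵐ t, 0 < t → t ^ p * φ t ≤ κ / 2 * deriv (fun r => -m r ^ 2) t := by
  filter_upwards [hm.neg.ae_differentiableAt] with t hd ht
  have hd' : HasDerivAt m (deriv m t) t := by
    have : DifferentiableAt ℝ m t := by simpa using hd.neg
    exact this.hasDerivAt
  have h2 : deriv (fun r => -m r ^ 2) t = -2 * m t * deriv m t := by
    refine (hd'.fun_pow 2).fun_neg.deriv.trans ?_
    simp
  have hslope := (hasDerivAt_iff_tendsto_slope.1 hd').mono_left
    (nhdsWithin_mono t (fun x (hx : x < t) => ne_of_lt hx))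
  have hmt : Filter.Tendsto m (nhdsWithin t (Iio t)) (nhds (m t)) :=
    hd'.continuousAt.tendsto.mono_left nhdsWithin_le_nhds
  have hpt : Filter.Tendsto (fun s : ℝ => s ^ p * φ t) (nhdsWithin t (Iio t))
      (nhds (t ^ p * φ t)) :=
    ((Real.continuousAt_rpow_const t p (.inl ht.ne')).tendsto.mono_left
      nhdsWithin_le_nhds).mul_const _
  have hR := (hmt.mul hslope.neg).const_mul κ
  have hle : t ^ p * φ t ≤ κ * (m t * -deriv m t) := by
    refine le_of_tendsto_of_tendsto hpt hR ?_
    filter_upwards [Ioo_mem_nhdsLT ht] with s hs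
    have hts : 0 < t - s := sub_pos.2 hs.2
    have h1 := h s t hs.1 hs.2
    have h3 : -slope m t s = (m s - m t) / (t - s) := by
      rw [slope_def_field, ← neg_sub t s, div_neg, neg_neg]
    rw [h3, ← mul_div_assoc, ← mul_div_assoc, le_div_iff₀ hts]
    linarith
  rw [h2]
  linarith

/-- Integrated form: a decay estimate for `m` bounds the weighted integral of `φ`. -/
theorem lintegral_Ioi_rpow_mul_le_of_antitone {m φ : ℝ → ℝ} {κ p T : ℝ} (hm : Antitone m)
    (hm0 : ∀ t, 0 ≤ m t) (hm1 : ∀ t, m t ≤ 1) (hκ : 0 ≤ κ) (hT : 0 ≤ T)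
    (hφT : ∀ t > T, φ t = 0)
    (h : ∀ s t, 0 < s → s < t → (t - s) * s ^ p * φ t ≤ κ * (m s * (m s - m t))) :
    ∫⁻ t in Ioi 0, ENNReal.ofReal (t ^ p * φ t) ≤ ENNReal.ofReal (κ / 2) := by
  let f : ℝ → ℝ := fun r => -m r ^ 2
  have hf : Monotone f := fun a b hab => by
    have := hm hab
    have := hm0 b
    simp only [f]
    nlinarith
  have hfi : IntervalIntegrable (deriv f) volume 0 T :=
    (hf.monotoneOn _).intervalIntegrable_deriv
  have hfle : ∫ t in (0 : ℝ)..T, deriv f t ≤ 1 := by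
    have h1 := (hf.monotoneOn (uIcc 0 T)).intervalIntegral_deriv_mem_uIcc
    rw [uIcc_of_le (sub_nonneg.2 (hf hT))] at h1
    refine h1.2.trans ?_
    have := hm0 0
    have := hm1 0
    simp only [f]
    nlinarith [sq_nonneg (m T)]
  have hf0 : ∀ t, 0 ≤ deriv f t := fun t => hf.deriv_nonneg
  calc ∫⁻ t in Ioi 0, ENNReal.ofReal (t ^ p * φ t)
      ≤ ∫⁻ t in Ioi 0, (Ioc 0 T).indicator (fun t => ENNReal.ofReal (κ / 2 * deriv f t)) t := by
        refine setLIntegral_mono_ae' measurableSet_Ioi ?_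
        filter_upwards [ae_le_deriv_neg_sq_of_antitone hm h] with t ht ht0
        by_cases htT : t ≤ T
        · have hmem : t ∈ Ioc 0 T := ⟨ht0, htT⟩
          rw [indicator_of_mem hmem]
          exact ENNReal.ofReal_le_ofReal (ht ht0)
        · simp [hφT t (not_le.1 htT)]
    _ = ∫⁻ t in Ioc 0 T, ENNReal.ofReal (κ / 2 * deriv f t) := by
        rw [lintegral_indicator measurableSet_Ioc, Measure.restrict_restrict measurableSet_Ioc,
          inter_eq_left.2 Ioc_subset_Ioi_self]
    _ = ENNReal.ofReal (∫ t in Ioc 0 T, κ / 2 * deriv f t) := by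
        rw [ofReal_integral_eq_lintegral_ofReal]
        · exact ((intervalIntegrable_iff_integrableOn_Ioc_of_le hT).1 hfi).const_mul _
        · exact .of_forall fun t => mul_nonneg (by positivity) (hf0 t)
    _ ≤ ENNReal.ofReal (κ / 2) := by
        refine ENNReal.ofReal_le_ofReal ?_
        rw [integral_const_mul, ← intervalIntegral.integral_of_le hT]
        nlinarith

/-- Sharp a priori bound `∫ u₊^(p+1) ≤ λ (p+1) / (8π)` when `-Δu = λ u₊^p`, `∫ u₊^p = 1`. -/
theorem integral_rpow_add_one_le {Ω : Set (EuclideanSpace ℝ (Fin 2))}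
    {u : EuclideanSpace ℝ (Fin 2) → ℝ} {p lam : ℝ} (hΩ : IsOpen Ω) (hΩb : Bornology.IsBounded Ω)
    (hu : ContDiff ℝ 2 u) (hu0 : ∀ x ∈ frontier Ω, u x ≤ 0) (hp : 0 < p) (hlam : 0 ≤ lam)
    (hpde : ∀ x ∈ Ω, -lapl u x = lam * max (u x) 0 ^ p)
    (hmass : ∫ x in Ω, max (u x) 0 ^ p = 1) :
    ∫ x in Ω, max (u x) 0 ^ (p + 1) ≤ lam * (p + 1) / (8 * Real.pi) := by
  have hcont : ∀ q : ℝ, 0 < q → Continuous fun x => max (u x) 0 ^ q := fun q hq =>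
    (hu.continuous.max continuous_const).rpow_const fun _ => .inr hq.le
  have hint : ∀ S ⊆ Ω, ∀ q : ℝ, 0 < q → IntegrableOn (fun x => max (u x) 0 ^ q) S :=
    fun S hS q hq => (hcont q hq).integrableOn_of_isBounded (hΩb.subset hS)
  have hnn : ∀ (q : ℝ) x, 0 ≤ max (u x) 0 ^ q := fun q x =>
    Real.rpow_nonneg (le_max_right _ _) q
  let L : ℝ → Set (EuclideanSpace ℝ (Fin 2)) := fun r => Ω ∩ {x | r < u x}
  have hLm : ∀ r, MeasurableSet (L r) := fun r =>
    hΩ.measurableSet.inter (measurableSet_lt measurable_const hu.continuous.measurable)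
  have hLfin : ∀ r, volume (L r) ≠ ∞ := fun r =>
    (hΩb.subset inter_subset_left).measure_lt_top.ne
  have hLanti : ∀ {s t : ℝ}, s ≤ t → L t ⊆ L s := fun hst x hx => ⟨hx.1, hst.trans_lt hx.2⟩
  let m : ℝ → ℝ := fun r => ∫ x in L r, max (u x) 0 ^ p
  have hm : Antitone m := fun s t hst => setIntegral_mono_set (hint _ inter_subset_left p hp)
    (.of_forall (hnn p)) (hLanti hst).eventuallyLE
  have hm0 : ∀ t, 0 ≤ m t := fun t => integral_nonneg (hnn p)
  have hm1 : ∀ t, m t ≤ 1 := fun t => hmass ▸ setIntegral_mono_set (hint _ subset_rfl p hp)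
    (.of_forall (hnn p)) (inter_subset_left : L t ⊆ Ω).eventuallyLE
  obtain ⟨T, hT⟩ := (hΩb.isCompact_closure.bddAbove_image hu.continuous.continuousOn)
  have huT : ∀ x ∈ Ω, u x ≤ T := fun x hx => hT ⟨x, subset_closure hx, rfl⟩
  have hdecay : ∀ s t, 0 < s → s < t → (t - s) * s ^ p * volume.real (L t) ≤
      lam / (4 * Real.pi) * (m s * (m s - m t)) := by
    intro s t hs hst
    have h1 := four_pi_mul_measure_superlevel_le hΩ hΩb hu hu0
      (fun x hx => by rw [hpde x hx]; exact mul_nonneg hlam (hnn p x)) hs hst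
    have h2 : ∫ x in Ω ∩ {x | s < u x}, -lapl u x = lam * m s := by
      rw [setIntegral_congr_fun (hLm s) fun x hx => hpde x hx.1, integral_const_mul]
    rw [h2] at h1
    have h3 : s ^ p * (volume.real (L s) - volume.real (L t)) ≤ m s - m t := by
      have e1 : volume.real (L s \ L t) = volume.real (L s) - volume.real (L t) :=
        measureReal_sdiff (hLanti hst.le) (hLm t) (h₁ := hLfin s)
      have e2 : ∫ x in L s \ L t, max (u x) 0 ^ p = m s - m t :=
        setIntegral_sdiff (hLm t) (hint _ inter_subset_left p hp) (hLanti hst.le)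
      rw [← e1, ← e2, mul_comm, ← smul_eq_mul, ← setIntegral_const]
      refine setIntegral_mono_on
        (integrableOn_const (measure_ne_top_of_subset sdiff_subset (hLfin s)))
        (hint _ (sdiff_subset.trans inter_subset_left) p hp) ((hLm s).diff (hLm t)) fun x hx => ?_
      exact Real.rpow_le_rpow hs.le (le_max_of_le_left (le_of_lt hx.1.2)) hp.le
    have hsp : 0 ≤ s ^ p := Real.rpow_nonneg hs.le p
    have h4 : 4 * Real.pi * ((t - s) * s ^ p * volume.real (L t)) ≤
        lam * (m s * (m s - m t)) := by
      have h5 := mul_le_mul_of_nonneg_left h1 hsp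
      have h6 := mul_le_mul_of_nonneg_left h3 (mul_nonneg hlam (hm0 s))
      simp only [L] at h6 ⊢
      linarith
    rw [div_mul_eq_mul_div, le_div_iff₀ (by positivity)]
    linarith
  have hmain := lintegral_Ioi_rpow_mul_le_of_antitone hm hm0 hm1
    (κ := lam / (4 * Real.pi)) (by positivity) (le_max_right T 0) (fun t ht => by
      have : L t = ∅ := eq_empty_of_forall_notMem fun x hx =>
        ((le_max_left T 0).trans_lt ht).not_ge (le_trans (le_of_lt hx.2) (huT x hx.1))
      simp [this]) hdecay
  have hcake := lintegral_rpow_eq_lintegral_meas_lt_mul (volume.restrict Ω)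
    (f := fun x => max (u x) 0) (.of_forall fun x => le_max_right _ _)
    (hu.continuous.max continuous_const).measurable.aemeasurable (p := p + 1) (by positivity)
  rw [← ofReal_integral_eq_lintegral_ofReal (hint Ω subset_rfl _ (by positivity))
    (.of_forall (hnn (p + 1)))] at hcake
  have hcongr : ∫⁻ t in Ioi (0 : ℝ), volume.restrict Ω {x | t < max (u x) 0} *
      ENNReal.ofReal (t ^ (p + 1 - 1)) =
        ∫⁻ t in Ioi (0 : ℝ), ENNReal.ofReal (t ^ p * volume.real (L t)) := by
    refine setLIntegral_congr_fun measurableSet_Ioi fun t ht => ?_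
    have ht' : 0 < t := ht
    have e : {x | t < max (u x) 0} ∩ Ω = L t := by
      ext x
      simp [L, ht'.not_gt, and_comm]
    rw [Measure.restrict_apply' hΩ.measurableSet, e, add_sub_cancel_right,
      ENNReal.ofReal_mul (Real.rpow_nonneg ht'.le p), ofReal_measureReal (hLfin t), mul_comm]
  rw [hcongr] at hcake
  have := hcake.le.trans (mul_le_mul_right hmain _)
  rw [← ENNReal.ofReal_mul (by positivity), ENNReal.ofReal_le_ofReal_iff (by positivity)] at this
  refine this.trans (le_of_eq ?_)
  field_simp
  ring

/-- Smooth approximation of a compactly supported `C¹` function, with derivatives. -/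
theorem exists_contDiff_tendsto {N : ℕ} {Ω : Set (EuclideanSpace ℝ (Fin N))}
    {w : EuclideanSpace ℝ (Fin N) → ℝ} (hΩ : IsOpen Ω) (hw : ContDiff ℝ 1 w)
    (hwc : HasCompactSupport w) (hwΩ : tsupport w ⊆ Ω) :
    ∃ (v : ℕ → EuclideanSpace ℝ (Fin N) → ℝ) (C : ℝ),
      (∀ n, ContDiff ℝ (⊤ : ℕ∞) (v n)) ∧ (∀ n, HasCompactSupport (v n)) ∧
      (∀ n, tsupport (v n) ⊆ Ω) ∧ (∀ n x, ‖v n x‖ ≤ C) ∧ (∀ n x, ‖fderiv ℝ (v n) x‖ ≤ C) ∧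
      (∀ x, Filter.Tendsto (fun n => v n x) Filter.atTop (nhds (w x))) ∧
      ∀ x, Filter.Tendsto (fun n => fderiv ℝ (v n) x) Filter.atTop (nhds (fderiv ℝ w x)) := by
  have hw' : Continuous (fderiv ℝ w) := hw.continuous_fderiv one_ne_zero
  obtain ⟨δ, hδ, hδΩ⟩ := IsCompact.exists_cthickening_subset_open hwc hΩ hwΩ
  let φ : ℕ → ContDiffBump (0 : EuclideanSpace ℝ (Fin N)) := fun n =>
    ⟨δ / 2 / (n + 1), δ / (n + 1), by positivity, by gcongr; linarith⟩
  have hφ : Filter.Tendsto (fun n => (φ n).rOut) Filter.atTop (nhds 0) :=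
    tendsto_const_nhds.div_atTop
      (Filter.tendsto_atTop_add_const_right _ 1 tendsto_natCast_atTop_atTop)
  have hφδ : ∀ n, (φ n).rOut ≤ δ := fun n => div_le_self hδ.le (by simp)
  have hφi : ∀ n, LocallyIntegrable ((φ n).normed volume) volume := fun n =>
    (φ n).integrable_normed.locallyIntegrable
  let v : ℕ → EuclideanSpace ℝ (Fin N) → ℝ := fun n =>
    convolution ((φ n).normed volume) w (ContinuousLinearMap.lsmul ℝ ℝ) volume
  have hd : ∀ n x, fderiv ℝ (v n) x = convolution ((φ n).normed volume) (fderiv ℝ w)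
      (ContinuousLinearMap.lsmul ℝ ℝ) volume x := fun n x =>
    (hwc.hasFDerivAt_convolution_right _ (hφi n) hw x).fderiv
  have hsub : ∀ n, tsupport (v n) ⊆ cthickening δ (tsupport w) := fun n => by
    refine closure_minimal ?_ isClosed_cthickening
    refine (support_convolution_subset _).trans ?_
    rw [(φ n).support_normed_eq, add_comm]
    rintro _ ⟨a, ha, b, hb, rfl⟩
    refine mem_cthickening_of_dist_le _ a _ _ (subset_tsupport _ ha) ?_
    have : ‖b‖ < (φ n).rOut := by simpa using hb
    simpa [dist_eq_norm] using this.le.trans (hφδ n)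
  have hbd : ∀ {F : Type} [NormedAddCommGroup F] [NormedSpace ℝ F] [CompleteSpace F]
      (g : EuclideanSpace ℝ (Fin N) → F) (B : ℝ) (n : ℕ) (x), Continuous g → (∀ y, ‖g y‖ ≤ B) →
      ‖convolution ((φ n).normed volume) g (ContinuousLinearMap.lsmul ℝ ℝ) volume x‖ ≤
        3 * B := by
    intro F _ _ _ g B n x hg hB
    have h1 := (φ n).dist_normed_convolution_le (μ := volume) (x₀ := x) (ε := B + B)
      hg.aestronglyMeasurable fun y _ =>
        (dist_le_norm_add_norm _ _).trans (add_le_add (hB y) (hB x))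
    have h2 := norm_le_norm_add_norm_sub' (convolution ((φ n).normed volume) g
      (ContinuousLinearMap.lsmul ℝ ℝ) volume x) (g x)
    rw [← dist_eq_norm] at h2
    linarith [hB x]
  obtain ⟨B₁, hB₁⟩ := hwc.exists_bound_of_continuous hw.continuous
  obtain ⟨B₂, hB₂⟩ := (hwc.fderiv ℝ).exists_bound_of_continuous hw'
  refine ⟨v, max (3 * B₁) (3 * B₂), fun n => ?_, fun n => ?_, fun n => (hsub n).trans hδΩ,
    fun n x => ?_, fun n x => ?_, fun x => ?_, fun x => ?_⟩
  · exact (φ n).hasCompactSupport_normed.contDiff_convolution_left _ (φ n).contDiff_normed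
      hw.continuous.locallyIntegrable
  · exact HasCompactSupport.of_support_subset_isCompact (IsCompact.cthickening hwc)
      ((subset_tsupport _).trans (hsub n))
  · exact le_max_of_le_left (hbd w B₁ n x hw.continuous hB₁)
  · rw [hd]
    exact le_max_of_le_right (hbd _ B₂ n x hw' hB₂)
  · exact ContDiffBump.convolution_tendsto_right_of_continuous hφ hw.continuous x
  · simp_rw [hd]
    exact ContDiffBump.convolution_tendsto_right_of_continuous hφ hw' x

theorem Lam_nonneg {N : ℕ} (Ω : Set (EuclideanSpace ℝ (Fin N))) (t : ℝ) : 0 ≤ Lam Ω t := by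
  refine Real.sInf_nonneg ?_
  rintro _ ⟨w, -, -, -, -, rfl⟩
  exact div_nonneg (integral_nonneg fun x => by positivity)
    (Real.rpow_nonneg (integral_nonneg fun x => by positivity) _)

theorem norm_gradient {N : ℕ} (w : EuclideanSpace ℝ (Fin N) → ℝ) (x) :
    ‖gradient w x‖ = ‖fderiv ℝ w x‖ :=
  (InnerProductSpace.toDual ℝ _).symm.norm_map _

/-- The Sobolev inequality with constant `Lam Ω t` for smooth functions. -/
theorem Lam_mul_le_of_contDiff_top {N : ℕ} {Ω : Set (EuclideanSpace ℝ (Fin N))} {t : ℝ}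
    (ht : 0 < t) {w : EuclideanSpace ℝ (Fin N) → ℝ} (hw : ContDiff ℝ (⊤ : ℕ∞) w)
    (hwc : HasCompactSupport w) (hwΩ : tsupport w ⊆ Ω) :
    Lam Ω t * (∫ x in Ω, |w x| ^ t) ^ (2 / t) ≤ ∫ x in Ω, ‖fderiv ℝ w x‖ ^ 2 := by
  have hD0 : 0 ≤ ∫ x in Ω, |w x| ^ t := integral_nonneg fun x => by positivity
  have hnum : 0 ≤ ∫ x in Ω, ‖fderiv ℝ w x‖ ^ 2 := integral_nonneg fun x => by positivity
  rcases hD0.eq_or_lt with hD | hD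
  · rw [← hD, Real.zero_rpow (by positivity), mul_zero]
    exact hnum
  · rw [← le_div_iff₀ (Real.rpow_pos_of_pos hD _)]
    refine csInf_le ⟨0, ?_⟩ ⟨w, hw, hwc, hwΩ, ?_, by simp only [norm_gradient]⟩
    · rintro _ ⟨w, -, -, -, -, rfl⟩
      exact div_nonneg (integral_nonneg fun x => by positivity)
        (Real.rpow_nonneg (integral_nonneg fun x => by positivity) _)
    · rintro rfl
      simp [Real.zero_rpow ht.ne'] at hD

/-- The Sobolev inequality with constant `Lam Ω t` for `C¹` functions. -/
theorem Lam_mul_le_of_contDiff_one {N : ℕ} {Ω : Set (EuclideanSpace ℝ (Fin N))} {t : ℝ}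
    (ht : 0 < t) (hΩ : IsOpen Ω) (hΩb : Bornology.IsBounded Ω)
    {w : EuclideanSpace ℝ (Fin N) → ℝ} (hw : ContDiff ℝ 1 w)
    (hwc : HasCompactSupport w) (hwΩ : tsupport w ⊆ Ω) :
    Lam Ω t * (∫ x in Ω, |w x| ^ t) ^ (2 / t) ≤ ∫ x in Ω, ‖fderiv ℝ w x‖ ^ 2 := by
  obtain ⟨v, C, hv, hvc, hvΩ, hvC, hvC', hlim, hlim'⟩ := exists_contDiff_tendsto hΩ hw hwc hwΩ
  have hfin : IsFiniteMeasure (volume.restrict Ω) := isFiniteMeasure_restrict.2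
    hΩb.measure_lt_top.ne
  have h1 : Filter.Tendsto (fun n => ∫ x in Ω, |v n x| ^ t) Filter.atTop
      (nhds (∫ x in Ω, |w x| ^ t)) := by
    refine tendsto_integral_of_dominated_convergence (fun _ => C ^ t) (fun n => ?_)
      (integrable_const _) (fun n => .of_forall fun x => ?_) (.of_forall fun x => ?_)
    · exact ((hv n).continuous.abs.rpow_const fun _ => .inr ht.le).aestronglyMeasurable
    · rw [Real.norm_of_nonneg (by positivity)]
      exact Real.rpow_le_rpow (abs_nonneg _) (hvC n x) ht.le
    · exact (hlim x).abs.rpow_const (.inr ht.le)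
  have h2 : Filter.Tendsto (fun n => ∫ x in Ω, ‖fderiv ℝ (v n) x‖ ^ 2) Filter.atTop
      (nhds (∫ x in Ω, ‖fderiv ℝ w x‖ ^ 2)) := by
    refine tendsto_integral_of_dominated_convergence (fun _ => C ^ 2) (fun n => ?_)
      (integrable_const _) (fun n => .of_forall fun x => ?_) (.of_forall fun x => ?_)
    · exact (((hv n).continuous_fderiv (by simp)).norm.pow 2).aestronglyMeasurable
    · rw [Real.norm_of_nonneg (by positivity)]
      exact pow_le_pow_left₀ (norm_nonneg _) (hvC' n x) 2
    · exact (hlim' x).norm.pow 2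
  exact le_of_tendsto_of_tendsto' ((h1.rpow_const (.inr (by positivity))).const_mul _) h2
    fun n => Lam_mul_le_of_contDiff_top ht (hv n) (hvc n) (hvΩ n)

/-- Testing the Sobolev inequality with the positive part of a solution of `-Δu = λ u₊^p`. -/
theorem Lam_mul_integral_rpow_le {N : ℕ} {Ω : Set (EuclideanSpace ℝ (Fin N))}
    {u : EuclideanSpace ℝ (Fin N) → ℝ} {p lam : ℝ} (hΩ : IsOpen Ω) (hΩb : Bornology.IsBounded Ω)
    (hu : ContDiff ℝ 2 u) (hu0 : ∀ x ∈ frontier Ω, u x ≤ 0) (hp : 0 < p) (hlam : 0 ≤ lam)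
    (hpde : ∀ x ∈ Ω, -lapl u x = lam * max (u x) 0 ^ p) :
    Lam Ω (p + 1) * (∫ x in Ω, max (u x) 0 ^ (p + 1)) ^ (2 / (p + 1)) ≤
      lam * ∫ x in Ω, max (u x) 0 ^ (p + 1) := by
  have hp1 : 0 < p + 1 := by linarith
  have hcont : ∀ s : ℝ, Continuous fun x => max (u x - 2 * s) 0 ^ (p + 1) := fun s =>
    ((hu.continuous.sub continuous_const).max continuous_const).rpow_const fun _ => .inr hp1.le
  have hcont0 : Continuous fun x => max (u x) 0 ^ (p + 1) := by simpa using hcont 0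
  obtain ⟨T, hT⟩ := hΩb.isCompact_closure.bddAbove_image hu.continuous.continuousOn
  have huT : ∀ x ∈ Ω, u x ≤ T := fun x hx => hT ⟨x, subset_closure hx, rfl⟩
  have key : ∀ s : ℝ, 0 < s →
      Lam Ω (p + 1) * (∫ x in Ω, max (u x - 2 * s) 0 ^ (p + 1)) ^ (2 / (p + 1)) ≤
        lam * ∫ x in Ω, max (u x) 0 ^ (p + 1) := by
    intro s hs
    obtain ⟨G, hGd, hG'0, hG'1, hGs, hG0, -, hGt, -, -⟩ := exists_truncation
      (s := s) (t := max T 0 + 2 * s) (c := max T 0) (by linarith [le_max_right T 0])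
      (by linarith)
    have hGdiff := hGd.differentiable one_ne_zero
    have hGu : ∀ r, G r ≤ max r 0 := fun r => by
      rcases le_total r s with h | h
      · rw [hGs r h]
        exact le_max_right _ _
      · have := image_sub_le_mul_sub_of_deriv_le hGdiff hG'1 h
        rw [hGs s le_rfl] at this
        exact le_max_of_le_left (by linarith)
    have hGl : ∀ r ≤ max T 0 + 2 * s, max (r - 2 * s) 0 ≤ G r := fun r hr => by
      have h1 := image_sub_le_mul_sub_of_deriv_le hGdiff hG'1 hr
      exact max_le (by linarith [hGt _ le_rfl]) (hG0 r)
    have hwc := hasCompactSupport_indicator_comp hΩb hu.continuous hGs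
    have hwd := contDiff_indicator_comp hΩ hΩb (hu.of_le one_le_two) hu0 hs hGs hGd
    have henergy := integral_norm_fderiv_indicator_comp_sq_le hΩ hΩb hu hu0 hs hGs hGd hG'0 hG'1
    have hSob := Lam_mul_le_of_contDiff_one hp1 hΩ hΩb hwd hwc
      (tsupport_indicator_comp_subset hΩ hΩb hu.continuous hu0 hs hGs)
    have hle : ∫ x in Ω, max (u x - 2 * s) 0 ^ (p + 1) ≤
        ∫ x in Ω, |Ω.indicator (fun x => G (u x)) x| ^ (p + 1) := by
      refine setIntegral_mono_on ((hcont s).integrableOn_of_isBounded hΩb)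
        ((hwd.continuous.abs.rpow_const fun _ => .inr hp1.le).integrableOn_of_isBounded hΩb)
        hΩ.measurableSet fun x hx => ?_
      rw [indicator_of_mem hx, abs_of_nonneg (hG0 _)]
      exact Real.rpow_le_rpow (le_max_right _ _)
        (hGl _ (by linarith [huT x hx, le_max_left T 0])) hp1.le
    have hset : ∫ x in Ω, ‖fderiv ℝ (Ω.indicator fun x => G (u x)) x‖ ^ 2 =
        ∫ x, ‖fderiv ℝ (Ω.indicator fun x => G (u x)) x‖ ^ 2 :=
      setIntegral_eq_integral_of_forall_compl_eq_zero fun x hx => by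
        rw [fderiv_indicator_comp_of_notMem hΩ hΩb hu.continuous hu0 hs hGs hx]
        simp
    calc Lam Ω (p + 1) * (∫ x in Ω, max (u x - 2 * s) 0 ^ (p + 1)) ^ (2 / (p + 1))
        ≤ Lam Ω (p + 1) *
          (∫ x in Ω, |Ω.indicator (fun x => G (u x)) x| ^ (p + 1)) ^ (2 / (p + 1)) := by
          refine mul_le_mul_of_nonneg_left (Real.rpow_le_rpow
            (integral_nonneg fun x => Real.rpow_nonneg (le_max_right _ _) _) hle
            (by positivity)) (Lam_nonneg _ _)
      _ ≤ ∫ x in Ω, G (u x) * -lapl u x := hSob.trans (hset.trans_le henergy)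
      _ ≤ ∫ x in Ω, lam * max (u x) 0 ^ (p + 1) := by
          refine setIntegral_mono_on
            (((hGd.continuous.comp hu.continuous).mul
              (continuous_lapl hu).neg).integrableOn_of_isBounded hΩb)
            ((continuous_const.mul hcont0).integrableOn_of_isBounded hΩb)
            hΩ.measurableSet fun x hx => ?_
          have hm : 0 ≤ max (u x) 0 := le_max_right _ _
          rw [hpde x hx, Real.rpow_add_one' hm hp1.ne', mul_left_comm, mul_comm (G (u x))]
          gcongr
          exact hGu _
      _ = lam * ∫ x in Ω, max (u x) 0 ^ (p + 1) := integral_const_mul _ _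
  have hlim : Filter.Tendsto (fun s : ℝ => ∫ x in Ω, max (u x - 2 * s) 0 ^ (p + 1))
      (nhdsWithin 0 (Ioi 0)) (nhds (∫ x in Ω, max (u x) 0 ^ (p + 1))) := by
    refine tendsto_integral_filter_of_dominated_convergence (fun x => max (u x) 0 ^ (p + 1))
      (.of_forall fun s => (hcont s).aestronglyMeasurable) ?_
      (hcont0.integrableOn_of_isBounded hΩb) (.of_forall fun x => ?_)
    · filter_upwards [self_mem_nhdsWithin] with s hs
      have hs' : 0 < s := hs
      refine .of_forall fun x => ?_
      rw [Real.norm_of_nonneg (Real.rpow_nonneg (le_max_right _ _) _)]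
      exact Real.rpow_le_rpow (le_max_right _ _) (max_le_max_right _ (by linarith)) hp1.le
    · have h : Continuous fun s : ℝ => max (u x - 2 * s) 0 ^ (p + 1) :=
        ((continuous_const.sub (continuous_const.mul continuous_id)).max
          continuous_const).rpow_const fun _ => .inr hp1.le
      simpa using (h.tendsto 0).mono_left nhdsWithin_le_nhds
  refine le_of_tendsto ((hlim.rpow_const (.inr (by positivity))).const_mul _) ?_
  filter_upwards [self_mem_nhdsWithin] with s hs using key s hs

theorem lapl_const_add_const_mul {N : ℕ} (f : EuclideanSpace ℝ (Fin N) → ℝ) (a b : ℝ) (x) :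
    lapl (fun y => a + b * f y) x = b * lapl f x := by
  have h : ∀ y, fderiv ℝ (fun y => a + b * f y) y = b • fderiv ℝ f y := fun y => by
    rw [fderiv_const_add]
    exact congrFun (fderiv_const_smul_field (𝕜 := ℝ) (f := f) b) y
  simp only [lapl, h, Finset.mul_sum]
  refine Finset.sum_congr rfl fun i _ => ?_
  have := congrFun (fderiv_const_smul_field (𝕜 := ℝ)
    (f := fun y => fderiv ℝ f y (EuclideanSpace.single i (1 : ℝ))) b) x
  exact congrArg (fun L => L (EuclideanSpace.single i (1 : ℝ))) this

/-- The algebra combining the two bounds on `Y = ∫ u₊^(p+1)`. -/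
theorem rpow_mul_rpow_le_of_bounds {p Λ κ lam Y : ℝ} (hp : 1 ≤ p) (hΛ : 0 ≤ Λ) (hκ : 0 < κ)
    (hlam : 0 < lam) (hY : 0 < Y) (h1 : Y ≤ lam / κ) (h2 : Λ * Y ^ (2 / (p + 1)) ≤ lam * Y) :
    κ ^ ((p - 1) / (2 * p)) * Λ ^ ((p + 1) / (2 * p)) ≤ lam := by
  have hp0 : 0 < p := by linarith
  have hp1 : 0 < p + 1 := by linarith
  have hpm : 0 ≤ p - 1 := by linarith
  have h3 : Λ ≤ lam * (lam / κ) ^ ((p - 1) / (p + 1)) := by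
    have h4 : Y = Y ^ ((p - 1) / (p + 1)) * Y ^ (2 / (p + 1)) := by
      rw [← Real.rpow_add hY, ← add_div]
      rw [show p - 1 + 2 = p + 1 by ring, div_self hp1.ne', Real.rpow_one]
    have h5 : Λ ≤ lam * Y ^ ((p - 1) / (p + 1)) := by
      refine le_of_mul_le_mul_right ?_ (Real.rpow_pos_of_pos hY (2 / (p + 1)))
      rwa [mul_assoc, ← h4]
    refine h5.trans ?_
    gcongr
  have h6 : Λ ^ ((p + 1) / (2 * p)) ≤ lam * κ⁻¹ ^ ((p - 1) / (2 * p)) := by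
    refine (Real.rpow_le_rpow hΛ h3 (by positivity)).trans_eq ?_
    rw [div_eq_mul_inv lam κ, Real.mul_rpow hlam.le (by positivity),
      Real.mul_rpow hlam.le (by positivity), Real.mul_rpow (by positivity) (by positivity),
      ← Real.rpow_mul hlam.le, ← Real.rpow_mul (by positivity), ← mul_assoc,
      ← Real.rpow_add hlam]
    rw [show (p + 1) / (2 * p) + (p - 1) / (p + 1) * ((p + 1) / (2 * p)) = 1 by field_simp; ring,
      show (p - 1) / (p + 1) * ((p + 1) / (2 * p)) = (p - 1) / (2 * p) by field_simp,
      Real.rpow_one]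
  calc κ ^ ((p - 1) / (2 * p)) * Λ ^ ((p + 1) / (2 * p))
      ≤ κ ^ ((p - 1) / (2 * p)) * (lam * κ⁻¹ ^ ((p - 1) / (2 * p))) := by gcongr
    _ = lam := by
      rw [Real.inv_rpow hκ.le]
      field_simp

end IsoperimetricBound

theorem stmt5 (Ω : Set (EuclideanSpace ℝ (Fin 2))) (hΩ : IsC3Domain Ω)
    (hvol : volume Ω = 1) (p : ℝ) (hp : 1 ≤ p)
    (lam : ℝ) (hlam : 0 ≤ lam)
    (hlt : lam <
      (8 * Real.pi / (p + 1)) ^ ((p - 1) / (2 * p)) * Lam Ω (p + 1) ^ ((p + 1) / (2 * p)))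
    (α : ℝ) (ψ : EuclideanSpace ℝ (Fin 2) → ℝ) (hsol : IsSol Ω p lam α ψ) :
    0 < α := by
  obtain ⟨hopen, -, hbdd, -⟩ := hΩ
  obtain ⟨hψ, hpde, hbdry, hmass⟩ := hsol
  have hp0 : 0 < p := by linarith
  by_contra! hα
  rcases hlam.eq_or_lt with rfl | hlam'
  · simp [max_eq_right hα, Real.zero_rpow hp0.ne'] at hmass
  let u : EuclideanSpace ℝ (Fin 2) → ℝ := fun x => α + lam * ψ x
  have hu : ContDiff ℝ 2 u := contDiff_const.add (contDiff_const.mul hψ)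
  have hu0 : ∀ x ∈ frontier Ω, u x ≤ 0 := fun x hx => by simpa [u, hbdry x hx] using hα
  have hupde : ∀ x ∈ Ω, -lapl u x = lam * max (u x) 0 ^ p := fun x hx => by
    rw [lapl_const_add_const_mul, ← hpde x hx, mul_neg]
  have hY0 : 0 < ∫ x in Ω, max (u x) 0 ^ (p + 1) := by
    have hc : Continuous fun x => max (u x) 0 ^ (p + 1) :=
      (hu.continuous.max continuous_const).rpow_const fun _ => .inr (by linarith)
    refine (integral_nonneg fun x => Real.rpow_nonneg (le_max_right _ _) _).lt_of_ne fun h => ?_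
    have h0 := (integral_eq_zero_iff_of_nonneg
      (fun x => Real.rpow_nonneg (le_max_right (u x) 0) (p + 1))
      (hc.integrableOn_of_isBounded hbdd)).1 h.symm
    have h1 : ∫ x in Ω, max (u x) 0 ^ p = 0 := by
      refine integral_eq_zero_of_ae ?_
      filter_upwards [h0] with x hx
      have hx' := (Real.rpow_eq_zero (le_max_right (u x) 0) (by linarith)).1 hx
      simp [hx', Real.zero_rpow hp0.ne']
    exact one_ne_zero (hmass.symm.trans h1)
  refine hlt.not_ge (rpow_mul_rpow_le_of_bounds hp (Lam_nonneg _ _) (by positivity) hlam' hY0 ?_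
    (Lam_mul_integral_rpow_le hopen hbdd hu hu0 hp0 hlam hupde))
  rw [div_div_eq_mul_div]
  exact integral_rpow_add_one_le hopen hbdd hu hu0 hp0 hlam hupde hmass

end
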